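/- For every integer n ≥ 2, we have h(n, ⌊n/2⌋) = h(n, ⌈n/2⌉) = ⌈n/2⌉. -/

import Mathlib

/-- The generalized binomial coefficient `C(a,k) = a(a-1)⋯(a-k+1)/k!` for an integer `a`
and natural number `k`, as a rational number. -/
def genChoose (a : ℤ) (k : ℕ) : ℚ :=
  (∏ i ∈ Finset.range k, ((a : ℚ) - i)) / (Nat.factorial k)

/-- `hNM n m` is the maximum of the set of `q ∈ ℕ` with `q ≤ n + m` such that
`C(q-n, 2ℓ) + C(q-m, 2ℓ) ≥ C(q, 2ℓ)` for all integers `ℓ` with `1 ≤ ℓ ≤ ⌊q/2⌋`.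
For `n ≥ m ≥ 1` it equals the Hilbert depth of `S_{n,m}/I_{n,m}`. -/
noncomputable def hNM (n m : ℕ) : ℕ :=
  sSup {q : ℕ | q ≤ n + m ∧ ∀ ℓ : ℕ, 1 ≤ ℓ → ℓ ≤ q / 2 →
    genChoose (q : ℤ) (2 * ℓ) ≤
      genChoose ((q : ℤ) - n) (2 * ℓ) + genChoose ((q : ℤ) - m) (2 * ℓ)}

lemma genChoose_two (a : ℤ) : genChoose a 2 = a * (a - 1) / 2 := by
  simp [genChoose, Finset.prod_range_succ]

lemma genChoose_natCast_of_lt {a k : ℕ} (h : a < k) : genChoose (a : ℤ) k = 0 := by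
  rw [genChoose, Finset.prod_eq_zero (Finset.mem_range.2 h) (by simp), zero_div]

lemma genChoose_le_genChoose_sub {q n k : ℕ} (hk : Even k) (hk2 : 2 ≤ k) (hkq : k ≤ q)
    (hqn : 2 * q ≤ n + 1) : genChoose (q : ℤ) k ≤ genChoose ((q : ℤ) - n) k := by
  have hneg : ∏ i ∈ Finset.range k, ((((q : ℤ) - n : ℤ) : ℚ) - i) =
      ∏ i ∈ Finset.range k, ((n : ℚ) - q + i) := by
    have h := Finset.prod_neg (s := Finset.range k) (fun i : ℕ => (n : ℚ) - q + i)
    rw [Finset.card_range, hk.neg_one_pow, one_mul] at h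
    rw [← h]
    refine Finset.prod_congr rfl fun i _ => ?_
    push_cast
    ring
  unfold genChoose
  rw [hneg, ← Finset.prod_range_reflect (fun i : ℕ => (n : ℚ) - q + i)]
  refine div_le_div_of_nonneg_right
    (Finset.prod_le_prod (fun i hi => ?_) fun i hi => ?_) (Nat.cast_nonneg _)
  · have hi' : (i : ℚ) ≤ q := by
      exact_mod_cast ((Finset.mem_range.1 hi).trans_le hkq).le
    simpa using hi'
  · have hcast : ((k - 1 - i : ℕ) : ℚ) = k - 1 - i := by
      have := Finset.mem_range.1 hi
      rw [Nat.sub_sub, Nat.cast_sub (by omega)]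
      push_cast
      ring
    have h2 : (2 : ℚ) ≤ k := by exact_mod_cast hk2
    have hq : (2 : ℚ) * q ≤ n + 1 := by exact_mod_cast hqn
    rw [hcast]
    push_cast
    linarith

lemma genChoose_two_add_lt {n m q : ℕ} (hn : 2 ≤ n) (hm : m = n / 2 ∨ m = (n + 1) / 2)
    (hq : (n + 1) / 2 < q) (hqnm : q ≤ n + m) :
    genChoose ((q : ℤ) - n) 2 + genChoose ((q : ℤ) - m) 2 < genChoose (q : ℤ) 2 := by
  have key : ((q : ℤ) - n) * (q - n - 1) + ((q : ℤ) - m) * (q - m - 1) < (q : ℤ) * (q - 1) := by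
    obtain ⟨h, h', hm1⟩ | ⟨h, h', hm1⟩ | ⟨h, h', hm1⟩ :
        ((n : ℤ) = 2 * m ∧ (m : ℤ) + 1 ≤ q ∧ (1 : ℤ) ≤ m) ∨
        ((n : ℤ) = 2 * m - 1 ∧ (m : ℤ) + 1 ≤ q ∧ (1 : ℤ) ≤ m) ∨
        ((n : ℤ) = 2 * m + 1 ∧ (m : ℤ) + 2 ≤ q ∧ (1 : ℤ) ≤ m) := by omega
    all_goals
      have hu : (q : ℤ) ≤ n + m := by exact_mod_cast hqnm
      rw [h] at hu ⊢
      nlinarith [mul_nonneg (sub_nonneg.2 h') (sub_nonneg.2 hu)]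
  have key' : ((q : ℚ) - n) * (q - n - 1) + ((q : ℚ) - m) * (q - m - 1) < (q : ℚ) * (q - 1) := by
    exact_mod_cast key
  simp only [genChoose_two]
  push_cast
  linarith

lemma hNM_eq_half {n m : ℕ} (hn : 2 ≤ n) (hm : m = n / 2 ∨ m = (n + 1) / 2) :
    hNM n m = (n + 1) / 2 := by
  refine IsGreatest.csSup_eq ⟨⟨by omega, fun ℓ h1 hℓ => ?_⟩, fun q ⟨hq, h⟩ => ?_⟩
  · have hsub : (((n + 1) / 2 : ℕ) : ℤ) - m = (((n + 1) / 2 - m : ℕ) : ℤ) := by omega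
    rw [hsub, genChoose_natCast_of_lt (a := (n + 1) / 2 - m) (by omega), add_zero]
    exact genChoose_le_genChoose_sub (even_two_mul ℓ) (by omega) (by omega) (by omega)
  · by_contra! hlt
    exact (genChoose_two_add_lt hn hm hlt hq).not_ge (h 1 le_rfl (by omega))

/-- For every integer n ≥ 2, h(n, ⌊n/2⌋) = h(n, ⌈n/2⌉) = ⌈n/2⌉. -/
theorem hNM_half (n : ℕ) (hn : 2 ≤ n) :
    hNM n (n / 2) = (n + 1) / 2 ∧ hNM n ((n + 1) / 2) = (n + 1) / 2 :=
  ⟨hNM_eq_half hn (Or.inl rfl), hNM_eq_half hn (Or.inr rfl)⟩
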